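/- arXiv:1208.1883 — 2 statements merged into one kernel-verified Lean document; each statement's English description precedes it below -/
import Mathlib

section
/- Let 0 < s < ∞ and let f : ℝ → ℂ be smooth and 2π-periodic. Then f is Gevrey–Beurling of order s if and only if for every B > 0 there exists K_B > 0 such that |f̂(m)| ≤ K_B e^{-B ⟨m⟩^{1/s}} for all m ∈ ℤ. -/
/-- The `m`-th Fourier coefficient of a `2π`-periodic function `f : ℝ → ℂ`:
`f̂(m) = (1/(2π)) ∫₀^{2π} f x e^{-imx} dx`. -/
noncomputable def fourierCoeffPeriodic (f : ℝ → ℂ) (m : ℤ) : ℂ :=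
  (1 / (2 * (Real.pi : ℂ))) *
    ∫ x in (0 : ℝ)..(2 * Real.pi), f x * Complex.exp (-(Complex.I * (m : ℂ) * (x : ℂ)))

theorem norm_fourierCoeffPeriodic_le {g : ℝ → ℂ} {M : ℝ} (h : ∀ x, ‖g x‖ ≤ M) (m : ℤ) :
    ‖fourierCoeffPeriodic g m‖ ≤ M := by
  have hpi := Real.pi_pos
  have key : ‖∫ x in (0 : ℝ)..(2 * Real.pi),
      g x * Complex.exp (-(Complex.I * (m : ℂ) * (x : ℂ)))‖ ≤ M * |2 * Real.pi - 0| := by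
    refine intervalIntegral.norm_integral_le_of_norm_le_const fun x _ => ?_
    rw [norm_mul, Complex.norm_exp]
    simpa using h x
  have hn : ‖(1 / (2 * (Real.pi : ℂ)))‖ = 1 / (2 * Real.pi) := by
    simp [abs_of_pos hpi]
  rw [sub_zero, abs_of_pos (by positivity)] at key
  rw [fourierCoeffPeriodic, norm_mul, hn, div_mul_eq_mul_div, one_mul,
    div_le_iff₀ (by positivity)]
  exact key

theorem fourierCoeffPeriodic_deriv {g : ℝ → ℂ} (hg : ContDiff ℝ 1 g)
    (hper : ∀ x, g (x + 2 * Real.pi) = g x) (m : ℤ) :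
    fourierCoeffPeriodic (deriv g) m = Complex.I * m * fourierCoeffPeriodic g m := by
  set e : ℝ → ℂ := fun x => Complex.exp (-(Complex.I * (m : ℂ) * (x : ℂ))) with he
  have he' : ∀ x, HasDerivAt e (-(Complex.I * m) * e x) x := by
    intro x
    have h1 : HasDerivAt (fun x : ℝ => -(Complex.I * (m : ℂ) * (x : ℂ)))
        (-(Complex.I * m * 1)) x :=
      ((Complex.ofRealCLM.hasDerivAt (x := x)).const_mul (Complex.I * (m : ℂ))).neg
    convert h1.cexp using 1
    simp only [he]; ring
  have hec : Continuous e := by fun_prop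
  have hg' : ∀ x, HasDerivAt g (deriv g x) x := fun x =>
    (hg.differentiable (by simp) x).hasDerivAt
  have hgc : Continuous (deriv g) := hg.continuous_deriv le_rfl
  have ibp := intervalIntegral.integral_mul_deriv_eq_deriv_mul (a := 0) (b := 2 * Real.pi)
    (u := e) (v := g) (fun x _ => he' x) (fun x _ => hg' x)
    ((continuous_const.mul hec).intervalIntegrable _ _) (hgc.intervalIntegrable _ _)
  have e1 : e (2 * Real.pi) = 1 := by
    rw [he, Complex.exp_eq_one_iff]
    exact ⟨-m, by push_cast; ring⟩
  have e0 : e 0 = 1 := by simp [he]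
  have g0 : g (2 * Real.pi) = g 0 := by simpa using hper 0
  rw [e1, e0, g0, sub_self, zero_sub] at ibp
  simp only [mul_assoc, neg_mul, intervalIntegral.integral_neg,
    intervalIntegral.integral_const_mul, neg_neg] at ibp
  have c1 : ∫ x in (0 : ℝ)..(2 * Real.pi), deriv g x * e x
      = ∫ x in (0 : ℝ)..(2 * Real.pi), e x * deriv g x := by simp only [mul_comm]
  have c2 : ∫ x in (0 : ℝ)..(2 * Real.pi), g x * e x
      = ∫ x in (0 : ℝ)..(2 * Real.pi), e x * g x := by simp only [mul_comm]
  change _ * (∫ x in (0 : ℝ)..(2 * Real.pi), deriv g x * e x)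
    = _ * (_ * (∫ x in (0 : ℝ)..(2 * Real.pi), g x * e x))
  rw [c1, c2, ibp]
  ring

theorem iteratedDeriv_periodic {g : ℝ → ℂ} {c : ℝ} (hper : ∀ x, g (x + c) = g x) (k : ℕ) (x : ℝ) :
    iteratedDeriv k g (x + c) = iteratedDeriv k g x := by
  have h := congrFun (iteratedDeriv_comp_add_const k g c) x
  rw [← h]
  simp only [hper]

theorem fourierCoeffPeriodic_iteratedDeriv {g : ℝ → ℂ} (hg : ContDiff ℝ (⊤ : ℕ∞) g)
    (hper : ∀ x, g (x + 2 * Real.pi) = g x) (k : ℕ) (m : ℤ) :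
    fourierCoeffPeriodic (iteratedDeriv k g) m = (Complex.I * m) ^ k * fourierCoeffPeriodic g m := by
  induction k with
  | zero => simp
  | succ k ih =>
    have hk : ContDiff ℝ 1 (iteratedDeriv k g) :=
      (iteratedDeriv_eq_iterate (n := k) (f := g)) ▸
        ContDiff.iterate_deriv' 1 k (hg.of_le (by exact_mod_cast le_top))
    rw [iteratedDeriv_succ, fourierCoeffPeriodic_deriv hk (iteratedDeriv_periodic hper k), ih]
    ring

/-- A continuous periodic function is bounded by the sum of the norms of its Fourier
coefficients, as soon as these are dominated by a summable sequence. -/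
theorem norm_le_tsum_of_fourierCoeffPeriodic_le {g : ℝ → ℂ} (hg : Continuous g)
    (hper : ∀ x, g (x + 2 * Real.pi) = g x) {v : ℤ → ℝ} (hv : Summable v)
    (h : ∀ m, ‖fourierCoeffPeriodic g m‖ ≤ v m) (x : ℝ) : ‖g x‖ ≤ ∑' m, v m := by
  have : Fact (0 < 2 * Real.pi) := ⟨by positivity⟩
  have hp : Function.Periodic g (2 * Real.pi) := hper
  let G : C(AddCircle (2 * Real.pi), ℂ) := ⟨hp.lift, hg.quotient_lift _⟩
  have hG : ∀ y : ℝ, G (y : AddCircle (2 * Real.pi)) = g y := fun y => hp.lift_coe y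
  have hc : ∀ m, fourierCoeff G m = fourierCoeffPeriodic g m := by
    intro m
    rw [fourierCoeff_eq_intervalIntegral G m 0, zero_add, fourierCoeffPeriodic, Complex.real_smul]
    congr 1
    · push_cast; rfl
    · refine intervalIntegral.integral_congr fun y _ => ?_
      simp only [hG, fourier_coe_apply, smul_eq_mul]
      rw [mul_comm]
      congr 2
      have : (Real.pi : ℂ) ≠ 0 := by exact_mod_cast Real.pi_ne_zero
      push_cast
      field_simp
  have hs : Summable (fourierCoeff G) :=
    Summable.of_norm_bounded hv fun m => by rw [hc]; exact h m
  have hsum := has_pointwise_sum_fourier_series_of_summable hs (x : AddCircle (2 * Real.pi))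
  rw [hG] at hsum
  rw [← hsum.tsum_eq]
  refine tsum_of_norm_bounded hv.hasSum fun m => ?_
  rw [norm_smul, hc, fourier_apply, Circle.norm_coe, mul_one]
  exact h m

theorem pow_le_factorial_rpow_mul_exp {s b y : ℝ} (hs : 0 < s) (hb : 0 < b) (hy : 0 ≤ y) (k : ℕ) :
    y ^ k ≤ (b ^ (-s)) ^ k * (k.factorial : ℝ) ^ s * Real.exp (s * b * y ^ (1 / s)) := by
  have hu : 0 ≤ y ^ (1 / s) := by positivity
  have h1 := Real.pow_div_factorial_le_exp (b * y ^ (1 / s)) (by positivity) k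
  rw [div_le_iff₀ (by positivity)] at h1
  have h2 := Real.rpow_le_rpow (by positivity) h1 hs.le
  rw [Real.mul_rpow (by positivity) (by positivity), ← Real.exp_mul, mul_pow,
    Real.mul_rpow (by positivity) (by positivity), ← Real.rpow_pow_comm hb.le,
    ← Real.rpow_pow_comm hu, ← Real.rpow_mul hy, one_div_mul_cancel hs.ne', Real.rpow_one] at h2
  have h3 : (b ^ (-s)) ^ k * (b ^ s) ^ k = 1 := by
    rw [← mul_pow, ← Real.rpow_add hb]; simp
  calc y ^ k = (b ^ (-s)) ^ k * ((b ^ s) ^ k * y ^ k) := by rw [← mul_assoc, h3, one_mul]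
    _ ≤ (b ^ (-s)) ^ k * (Real.exp (b * y ^ (1 / s) * s) * (k.factorial : ℝ) ^ s) := by gcongr
    _ = _ := by rw [show b * y ^ (1 / s) * s = s * b * y ^ (1 / s) by ring]; ring

theorem le_exp_of_forall_mul_pow_le {s b t y C : ℝ} (hs : 0 < s) (hb : 0 < b) (ht : 0 ≤ t)
    (hy : 0 ≤ y) (hC : 0 ≤ C)
    (h : ∀ k : ℕ, t * y ^ k ≤ C * ((2 * b) ^ (-s)) ^ k * (k.factorial : ℝ) ^ s) :
    t ≤ 2 ^ s * C * Real.exp (-(s * b * y ^ (1 / s))) := by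
  have hterm : ∀ k : ℕ, t ^ (1 / s) * ((b * y ^ (1 / s)) ^ k / k.factorial)
      ≤ C ^ (1 / s) * (1 / 2) ^ k := by
    intro k
    have h1 := Real.rpow_le_rpow (by positivity) (h k) (one_div_pos.2 hs).le
    rw [Real.mul_rpow ht (by positivity), Real.mul_rpow (by positivity) (by positivity),
      Real.mul_rpow hC (by positivity), ← Real.rpow_pow_comm hy,
      ← Real.rpow_pow_comm (by positivity), ← Real.rpow_mul (by positivity),
      ← Real.rpow_mul (by positivity), mul_one_div_cancel hs.ne', Real.rpow_one,
      neg_mul, mul_one_div_cancel hs.ne', Real.rpow_neg_one] at h1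
    calc t ^ (1 / s) * ((b * y ^ (1 / s)) ^ k / k.factorial)
        = b ^ k / k.factorial * (t ^ (1 / s) * (y ^ (1 / s)) ^ k) := by rw [mul_pow]; ring
      _ ≤ b ^ k / k.factorial * (C ^ (1 / s) * (2 * b)⁻¹ ^ k * k.factorial) := by gcongr
      _ = _ := by
        have hk : (k.factorial : ℝ) ≠ 0 := by positivity
        have hb2 : b ^ k * (2 * b)⁻¹ ^ k = (1 / 2) ^ k := by
          rw [← mul_pow]
          congr 1
          field_simp
        rw [← hb2]
        field_simp
  have hexp : HasSum (fun k : ℕ => (b * y ^ (1 / s)) ^ k / (k.factorial : ℝ))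
      (Real.exp (b * y ^ (1 / s))) := by
    rw [Real.exp_eq_exp_ℝ]
    exact NormedSpace.expSeries_div_hasSum_exp _
  have hle := hasSum_le hterm (hexp.mul_left _) (hasSum_geometric_two.mul_left _)
  have h2 := Real.rpow_le_rpow (by positivity) hle hs.le
  rw [Real.mul_rpow (by positivity) (by positivity), Real.mul_rpow (by positivity) (by positivity),
    ← Real.rpow_mul ht, ← Real.rpow_mul hC, one_div_mul_cancel hs.ne', Real.rpow_one,
    Real.rpow_one, ← Real.exp_mul] at h2
  rw [Real.exp_neg, ← div_eq_mul_inv, le_div_iff₀ (Real.exp_pos _)]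
  calc t * Real.exp (s * b * y ^ (1 / s)) = t * Real.exp (b * y ^ (1 / s) * s) := by
        congr 2; ring
    _ ≤ C * 2 ^ s := h2
    _ = _ := mul_comm _ _

theorem sqrt_one_add_sq_rpow_le {p : ℝ} (hp : 0 ≤ p) (y : ℝ) :
    Real.sqrt (1 + y ^ 2) ^ p ≤ 2 ^ p * (1 + |y| ^ p) := by
  have h1 : Real.sqrt (1 + y ^ 2) ≤ 2 * max 1 |y| := by
    apply Real.sqrt_le_iff.2 ⟨by positivity, ?_⟩
    have := le_max_left 1 |y|
    have h2 : |y| ≤ max 1 |y| := le_max_right 1 |y|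
    have := abs_nonneg y
    rw [← sq_abs y]
    nlinarith
  calc Real.sqrt (1 + y ^ 2) ^ p ≤ (2 * max 1 |y|) ^ p :=
        Real.rpow_le_rpow (by positivity) h1 hp
    _ = 2 ^ p * (max 1 |y|) ^ p := Real.mul_rpow (by positivity) (by positivity)
    _ ≤ 2 ^ p * (1 + |y| ^ p) := by
      gcongr
      have : 0 ≤ |y| ^ p := by positivity
      rcases max_cases 1 |y| with ⟨h, _⟩ | ⟨h, _⟩ <;> rw [h] <;> simp [this]

theorem summable_exp_neg_sqrt_one_add_sq_rpow {s c : ℝ} (hs : 0 < s) (hc : 0 < c) :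
    Summable fun m : ℤ => Real.exp (-(c * Real.sqrt (1 + (m : ℝ) ^ 2) ^ (1 / s))) := by
  set D : ℝ := ((c / s) ^ (-s)) ^ 2 * (Nat.factorial 2 : ℝ) ^ s with hD
  have hD0 : 0 < D := by positivity
  have hsum : Summable fun m : ℤ => D * (1 / (m : ℝ) ^ 2) :=
    (Real.summable_one_div_int_pow.2 one_lt_two).mul_left D
  refine Summable.of_norm_bounded_eventually hsum ?_
  filter_upwards [(Set.finite_singleton (0 : ℤ)).compl_mem_cofinite] with m hm
  have hm' : (m : ℝ) ≠ 0 := by exact_mod_cast hm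
  have h := pow_le_factorial_rpow_mul_exp hs (div_pos hc hs)
    (Real.sqrt_nonneg (1 + (m : ℝ) ^ 2)) 2
  rw [Real.sq_sqrt (by positivity), mul_div_cancel₀ _ hs.ne', ← hD] at h
  rw [Real.norm_of_nonneg (Real.exp_pos _).le, Real.exp_neg, mul_one_div, ← one_div,
    div_le_div_iff₀ (Real.exp_pos _) (by positivity)]
  linarith

/-- A smooth `2π`-periodic function `f : ℝ → ℂ` is Gevrey–Beurling of order `s` if and only
if for every `B > 0` there exists `K_B > 0` with `|f̂(m)| ≤ K_B e^{-B ⟨m⟩^{1/s}}` for all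
`m ∈ ℤ`, where `⟨m⟩ = (1 + m²)^{1/2}`. -/
theorem gevreyBeurling_iff_fourier_decay (s : ℝ) (hs : 0 < s)
    (f : ℝ → ℂ) (hf : ContDiff ℝ (⊤ : ℕ∞) f) (hper : ∀ x : ℝ, f (x + 2 * Real.pi) = f x) :
    (∀ A > (0 : ℝ), ∃ C > (0 : ℝ), ∀ k : ℕ, ∀ x : ℝ,
        ‖iteratedDeriv k f x‖ ≤ C * A ^ k * ((Nat.factorial k : ℝ)) ^ s)
      ↔ (∀ B > (0 : ℝ), ∃ K > (0 : ℝ), ∀ m : ℤ,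
        ‖fourierCoeffPeriodic f m‖
          ≤ K * Real.exp (-B * (Real.sqrt (1 + (m : ℝ) ^ 2)) ^ (1 / s))) := by
  constructor
  · intro h B hB
    set b : ℝ := B * 2 ^ (1 / s) / s with hb_def
    have hb : 0 < b := by positivity
    obtain ⟨C, hC, hbound⟩ := h ((2 * b) ^ (-s)) (by positivity)
    refine ⟨2 ^ s * C * Real.exp (s * b), by positivity, fun m => ?_⟩
    have hdecay := le_exp_of_forall_mul_pow_le hs hb (norm_nonneg (fourierCoeffPeriodic f m))
      (abs_nonneg (m : ℝ)) hC.le fun k => by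
        have := norm_fourierCoeffPeriodic_le (hbound k) m
        rw [fourierCoeffPeriodic_iteratedDeriv hf hper, norm_mul, norm_pow, norm_mul,
          Complex.norm_I, one_mul, Complex.norm_intCast] at this
        rwa [mul_comm]
    refine hdecay.trans ?_
    rw [mul_assoc _ (Real.exp _), ← Real.exp_add]
    gcongr
    have hj := sqrt_one_add_sq_rpow_le (one_div_pos.2 hs).le (m : ℝ)
    have hsb : s * b = B * 2 ^ (1 / s) := by rw [hb_def]; field_simp
    rw [hsb]
    nlinarith
  · intro h A hA
    set b : ℝ := A ^ (-(1 / s)) with hb_def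
    have hb : 0 < b := by positivity
    have hbA : b ^ (-s) = A := by
      rw [hb_def, ← Real.rpow_mul hA.le, neg_mul_neg, one_div_mul_cancel hs.ne', Real.rpow_one]
    obtain ⟨K, hK, hbound⟩ := h (2 * (s * b)) (by positivity)
    have hsum := summable_exp_neg_sqrt_one_add_sq_rpow hs (mul_pos hs hb)
    set S := ∑' m : ℤ, Real.exp (-(s * b * Real.sqrt (1 + (m : ℝ) ^ 2) ^ (1 / s))) with hS
    have hS0 : 0 < S := hsum.tsum_pos (fun _ => (Real.exp_pos _).le) 0 (Real.exp_pos _)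
    refine ⟨K * S, by positivity, fun k x => ?_⟩
    have hcont : Continuous (iteratedDeriv k f) :=
      hf.continuous_iteratedDeriv k (by exact_mod_cast le_top)
    refine (norm_le_tsum_of_fourierCoeffPeriodic_le hcont (iteratedDeriv_periodic hper k)
      (hsum.mul_left (K * A ^ k * (k.factorial : ℝ) ^ s)) (fun m => ?_) x).trans_eq ?_
    · rw [fourierCoeffPeriodic_iteratedDeriv hf hper, norm_mul, norm_pow, norm_mul,
        Complex.norm_I, one_mul, Complex.norm_intCast]
      set y := Real.sqrt (1 + (m : ℝ) ^ 2) with hy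
      have hmy : |(m : ℝ)| ≤ y := Real.abs_le_sqrt (by linarith)
      have hp := pow_le_factorial_rpow_mul_exp hs hb (Real.sqrt_nonneg (1 + (m : ℝ) ^ 2)) k
      rw [hbA, ← hy] at hp
      calc |(m : ℝ)| ^ k * ‖fourierCoeffPeriodic f m‖
          ≤ (A ^ k * (k.factorial : ℝ) ^ s * Real.exp (s * b * y ^ (1 / s)))
            * (K * Real.exp (-(2 * (s * b)) * y ^ (1 / s))) := by
            gcongr
            · exact (pow_le_pow_left₀ (abs_nonneg _) hmy k).trans hp
            · exact hbound m
        _ = K * A ^ k * (k.factorial : ℝ) ^ s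
            * (Real.exp (s * b * y ^ (1 / s)) * Real.exp (-(2 * (s * b)) * y ^ (1 / s))) := by ring
        _ = _ := by rw [← Real.exp_add]; congr 2; ring
    · rw [tsum_mul_left]; ring
end

section
/- Let I be a countable index set, s > 0, and w : I → ℝ with w_i ≥ 1 for all i, and assume that for every ε > 0 the series Σ_i e^{-ε w_i^{1/s}} converges. Then the Beurling sequence space Λ_(s) is perfect: ((Λ_(s))^α)^α = Λ_(s), i.e. a function u : I → ℂ satisfies Σ_i |u_i v_i| < ∞ for every v ∈ (Λ_(s))^α if and only if u ∈ Λ_(s). -/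
variable {I : Type*}

/-- The Roumieu sequence space `Λ_s` over a weight `w : I → ℝ`:
`a ∈ Λ_s` iff there exist `K, B > 0` with `|a i| ≤ K e^{-B w_i^{1/s}}` for all `i`. -/
def RoumieuSeq (s : ℝ) (w : I → ℝ) (a : I → ℂ) : Prop :=
  ∃ K > (0 : ℝ), ∃ B > (0 : ℝ), ∀ i, ‖a i‖ ≤ K * Real.exp (-B * w i ^ (1 / s))

/-- The Beurling sequence space `Λ_(s)` over a weight `w : I → ℝ`:
`a ∈ Λ_(s)` iff for every `B > 0` there is `K_B > 0` with `|a i| ≤ K_B e^{-B w_i^{1/s}}`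
for all `i`. -/
def BeurlingSeq (s : ℝ) (w : I → ℝ) (a : I → ℂ) : Prop :=
  ∀ B > (0 : ℝ), ∃ K > (0 : ℝ), ∀ i, ‖a i‖ ≤ K * Real.exp (-B * w i ^ (1 / s))

/-- The α-dual of a set `S` of sequences: all `v` with `Σ_i |v_i a_i| < ∞` for all `a ∈ S`. -/
def AlphaDual (S : Set (I → ℂ)) : Set (I → ℂ) :=
  {v | ∀ a ∈ S, Summable fun i => ‖v i * a i‖}

theorem subset_alphaDual_alphaDual (S : Set (I → ℂ)) : S ⊆ AlphaDual (AlphaDual S) :=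
  fun u hu v hv => by simpa only [mul_comm] using hv u hu

theorem exp_mem_alphaDual_beurlingSeq {s : ℝ} {w : I → ℝ} {B : ℝ} (hB : 0 < B)
    (hsum : Summable fun i => Real.exp (-1 * w i ^ (1 / s))) :
    (fun i => (Real.exp (B * w i ^ (1 / s)) : ℂ)) ∈
      AlphaDual {a : I → ℂ | BeurlingSeq s w a} := by
  intro a ha
  obtain ⟨K, -, hK⟩ := ha (B + 1) (by positivity)
  refine (hsum.mul_left K).of_nonneg_of_le (fun i => norm_nonneg _) fun i => ?_
  rw [norm_mul, Complex.norm_of_nonneg (Real.exp_pos _).le]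
  calc Real.exp (B * w i ^ (1 / s)) * ‖a i‖
      ≤ Real.exp (B * w i ^ (1 / s)) * (K * Real.exp (-(B + 1) * w i ^ (1 / s))) := by
        gcongr
        exact hK i
    _ = K * Real.exp (-1 * w i ^ (1 / s)) := by
        rw [mul_left_comm, ← Real.exp_add]
        ring_nf

/-- The Beurling sequence space `Λ_(s)` is perfect: assuming
`Σ_i e^{-ε w_i^{1/s}} < ∞` for every `ε > 0`, one has `((Λ_(s))^α)^α = Λ_(s)`. -/
theorem beurling_perfect {I : Type*} [Countable I]
    (s : ℝ) (hs : 0 < s) (w : I → ℝ) (hw : ∀ i, 1 ≤ w i)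
    (hsum : ∀ ε > (0 : ℝ), Summable fun i => Real.exp (-ε * w i ^ (1 / s))) :
    AlphaDual (AlphaDual {a : I → ℂ | BeurlingSeq s w a}) = {a : I → ℂ | BeurlingSeq s w a} := by
  refine Set.Subset.antisymm (fun u hu B hB => ?_) (subset_alphaDual_alphaDual _)
  have h := hu _ (exp_mem_alphaDual_beurlingSeq hB (hsum 1 one_pos))
  refine ⟨(∑' i, ‖u i * (Real.exp (B * w i ^ (1 / s)) : ℂ)‖) + 1,
    add_pos_of_nonneg_of_pos (tsum_nonneg fun i => norm_nonneg _) one_pos, fun i => ?_⟩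
  have hi := h.le_tsum i fun j _ => norm_nonneg _
  rw [norm_mul, Complex.norm_of_nonneg (Real.exp_pos _).le] at hi
  rw [neg_mul, Real.exp_neg, ← div_eq_mul_inv, le_div_iff₀ (Real.exp_pos _)]
  exact hi.trans (le_add_of_nonneg_right zero_le_one)
end
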